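/- Let Δ ⊂ ℝⁿ be a nondegenerate simplex, f : Δ → ℝ convex, and let d be a divisor of n+1. Then Avg(f, Δ) ≤ (1/C(n+1, d)) · Σ_{K ⊂ N, |K| = d} Avg(f, Δ_K), the sum being over all d-element subsets K of N = {0,…,n}. -/

import Mathlib

open MeasureTheory

/-- The average value of `f` over a set `S` with respect to `d`-dimensional
Hausdorff measure. -/
noncomputable def avgH {n : ℕ} (f : EuclideanSpace ℝ (Fin n) → ℝ) (d : ℝ)
    (S : Set (EuclideanSpace ℝ (Fin n))) : ℝ :=
  ⨍ y in S, f y ∂(μH[d])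

open ProbabilityTheory

/-- The law of a family of independent exponential variables of rate one. -/
noncomputable def expPi (ι : Type*) [Fintype ι] : Measure (ι → ℝ) :=
  Measure.pi fun _ => expMeasure 1

/-- The point with (unnormalized) barycentric coordinates `t` with respect to `x`. -/
noncomputable def baryPoint {ι E : Type*} [Fintype ι] [AddCommGroup E] [Module ℝ E]
    (x : ι → E) (t : ι → ℝ) : E :=
  (∑ i, t i)⁻¹ • ∑ i, t i • x i

section Hull

variable {ι E : Type*} [Fintype ι] [AddCommGroup E] [Module ℝ E] {x : ι → E}

lemma mem_convexHull_range_iff {y : E} :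
    y ∈ convexHull ℝ (Set.range x) ↔
      ∃ w : ι → ℝ, (∀ i, 0 ≤ w i) ∧ ∑ i, w i = 1 ∧ ∑ i, w i • x i = y := by
  classical
  have h : convexHull ℝ (Set.range x) = Fintype.linearCombination ℝ x '' stdSimplex ℝ ι := by
    rw [← convexHull_basis_eq_stdSimplex, LinearMap.image_convexHull, ← Set.range_comp]
    congr 2
    ext i
    simp [Fintype.linearCombination_apply]
  rw [h]
  simp [stdSimplex, Fintype.linearCombination_apply, and_assoc]

lemma baryPoint_mem_convexHull {t : ι → ℝ} (ht : ∀ i, 0 ≤ t i) (hs : 0 < ∑ i, t i) :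
    baryPoint x t ∈ convexHull ℝ (Set.range x) := by
  refine mem_convexHull_range_iff.2 ⟨fun i => (∑ j, t j)⁻¹ * t i, fun i => ?_, ?_, ?_⟩
  · exact mul_nonneg (inv_nonneg.2 hs.le) (ht i)
  · rw [← Finset.mul_sum, inv_mul_cancel₀ hs.ne']
  · simp [baryPoint, Finset.smul_sum, mul_smul]

lemma nonneg_of_baryPoint_mem_convexHull (hx : AffineIndependent ℝ x) {t : ι → ℝ}
    (hs : 0 < ∑ i, t i) (h : baryPoint x t ∈ convexHull ℝ (Set.range x)) (i : ι) : 0 ≤ t i := by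
  obtain ⟨w, hw0, hw1, hw⟩ := mem_convexHull_range_iff.1 h
  have key := affineIndependent_iff.1 hx Finset.univ (fun i => t i - (∑ j, t j) * w i)
    (by simp [← Finset.mul_sum, hw1])
    (by simp only [sub_smul, mul_smul, Finset.sum_sub_distrib, ← Finset.smul_sum, hw, baryPoint]
        rw [smul_inv_smul₀ hs.ne', sub_self]) i (Finset.mem_univ i)
  rw [sub_eq_zero.1 key]
  exact mul_nonneg hs.le (hw0 i)

end Hull

section Exponential

instance : IsProbabilityMeasure (expMeasure 1) := isProbabilityMeasure_expMeasure one_pos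

instance (ι : Type*) [Fintype ι] : IsProbabilityMeasure (expPi ι) := by
  unfold expPi; infer_instance

lemma expMeasure_eq_withDensity (r : ℝ) :
    expMeasure r = volume.withDensity (exponentialPDF r) := rfl

lemma measurable_exponentialPDF (r : ℝ) : Measurable (exponentialPDF r) :=
  (measurable_exponentialPDFReal r).ennreal_ofReal

lemma integrable_exponentialPDFReal_one : Integrable (exponentialPDFReal 1) := by
  refine ⟨(measurable_exponentialPDFReal 1).aestronglyMeasurable, ?_⟩
  rw [hasFiniteIntegral_iff_ofReal (ae_of_all _ (exponentialPDFReal_nonneg one_pos))]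
  exact (lintegral_exponentialPDF_eq_one one_pos).trans_lt ENNReal.one_lt_top

lemma ae_expMeasure_pos : ∀ᵐ y ∂expMeasure 1, 0 < y := by
  rw [expMeasure_eq_withDensity, ae_withDensity_iff (measurable_exponentialPDF 1)]
  filter_upwards [Measure.ae_ne volume (0 : ℝ)] with y hy h
  by_contra hlt
  exact h (exponentialPDF_of_neg (lt_of_le_of_ne (not_lt.1 hlt) hy))

lemma lintegral_ofReal_expMeasure : ∫⁻ y, ENNReal.ofReal y ∂expMeasure 1 = 1 := by
  rw [expMeasure_eq_withDensity, lintegral_withDensity_eq_lintegral_mul _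
    (measurable_exponentialPDF 1) ENNReal.measurable_ofReal,
    ← lintegral_gammaPDF_eq_one (a := 2) two_pos one_pos]
  refine lintegral_congr fun y => ?_
  rcases lt_or_ge y 0 with hy | hy
  · simp [exponentialPDF_of_neg hy, gammaPDF_of_neg hy]
  · rw [Pi.mul_apply, exponentialPDF_of_nonneg hy, gammaPDF_of_nonneg hy,
      ← ENNReal.ofReal_mul (by positivity)]
    congr 1
    norm_num [Real.Gamma_two]
    ring

variable {ι : Type*} [Fintype ι]

lemma ae_expPi_pos : ∀ᵐ t ∂expPi ι, ∀ i, 0 < t i :=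
  Filter.eventually_all.2 fun _ =>
    (Measure.tendsto_eval_ae_ae (μ := fun _ : ι => expMeasure 1)).eventually ae_expMeasure_pos

lemma lintegral_ofReal_sum_expPi :
    ∫⁻ t, ENNReal.ofReal (∑ i, t i) ∂expPi ι = Fintype.card ι := by
  have h : ∀ᵐ t ∂expPi ι, ENNReal.ofReal (∑ i, t i) = ∑ i, ENNReal.ofReal (t i) := by
    filter_upwards [ae_expPi_pos] with t ht
    exact ENNReal.ofReal_sum_of_nonneg fun i _ => (ht i).le
  rw [lintegral_congr_ae h, lintegral_finsetSum _ fun i _ => by fun_prop]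
  have h1 (i : ι) : ∫⁻ t, ENNReal.ofReal (t i) ∂expPi ι = 1 := by
    rw [← lintegral_ofReal_expMeasure]
    exact (measurePreserving_eval (fun _ : ι => expMeasure 1) i).lintegral_comp
      ENNReal.measurable_ofReal
  simp [h1]

lemma expPi_eq_withDensity :
    expPi ι = volume.withDensity fun t => ∏ i, exponentialPDF 1 (t i) := by
  refine Measure.pi_eq fun s hs => ?_
  have hint (i : ι) : Integrable ((s i).indicator (exponentialPDFReal 1)) :=
    integrable_exponentialPDFReal_one.indicator (hs i)
  have hnn (i : ι) (y : ℝ) : 0 ≤ (s i).indicator (exponentialPDFReal 1) y :=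
    Set.indicator_nonneg (fun y _ => exponentialPDFReal_nonneg one_pos y) y
  have hind (i : ι) : expMeasure 1 (s i) =
      ENNReal.ofReal (∫ y, (s i).indicator (exponentialPDFReal 1) y) := by
    rw [expMeasure_eq_withDensity, withDensity_apply _ (hs i), ← lintegral_indicator (hs i),
      ofReal_integral_eq_lintegral_ofReal (hint i) (ae_of_all _ (hnn i))]
    refine lintegral_congr fun y => ?_
    by_cases hy : y ∈ s i <;> simp [hy, exponentialPDF]
  have hprod : Integrable (fun t : ι → ℝ => ∏ i, (s i).indicator (exponentialPDFReal 1) (t i)) :=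
    Integrable.fintype_prod hint
  simp_rw [hind]
  rw [withDensity_apply _ (MeasurableSet.univ_pi hs),
    ← lintegral_indicator (MeasurableSet.univ_pi hs),
    ← ENNReal.ofReal_prod_of_nonneg fun i _ => integral_nonneg (hnn i),
    ← integral_fintype_prod_volume_eq_prod (fun i => (s i).indicator (exponentialPDFReal 1)),
    ofReal_integral_eq_lintegral_ofReal hprod
      (ae_of_all _ fun t => Finset.prod_nonneg fun i _ => hnn i (t i))]
  refine lintegral_congr fun t => ?_
  rw [ENNReal.ofReal_prod_of_nonneg fun i _ => hnn i (t i)]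
  by_cases ht : t ∈ Set.univ.pi s
  · rw [Set.indicator_of_mem ht]
    refine Finset.prod_congr rfl fun i _ => ?_
    rw [Set.indicator_of_mem (ht i trivial), exponentialPDF]
  · rw [Set.indicator_of_notMem ht]
    obtain ⟨i, hi⟩ : ∃ i, t i ∉ s i := by simpa using ht
    exact (Finset.prod_eq_zero (Finset.mem_univ i) (by simp [hi])).symm

lemma prod_exponentialPDF_of_nonneg {t : ι → ℝ} (ht : ∀ i, 0 ≤ t i) :
    ∏ i, exponentialPDF 1 (t i) = ENNReal.ofReal (Real.exp (-∑ i, t i)) := by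
  simp_rw [fun i => exponentialPDF_of_nonneg (r := 1) (ht i), one_mul]
  rw [← ENNReal.ofReal_prod_of_nonneg fun i _ => (Real.exp_pos _).le, ← Real.exp_sum,
    Finset.sum_neg_distrib]

lemma expPi_map_restrict (K : Finset ι) : (expPi ι).map K.restrict = expPi K := by
  unfold expPi
  rw [← Measure.infinitePi_eq_pi, Measure.infinitePi_map_restrict]

end Exponential

section Pushforward

variable {ι V : Type*} [Fintype ι] [NormedAddCommGroup V] [NormedSpace ℝ V]
  [MeasurableSpace V] [BorelSpace V] {x : ι → V}

lemma measurable_baryPoint [SecondCountableTopology V] (x : ι → V) :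
    Measurable (baryPoint x) := by
  unfold baryPoint; fun_prop

lemma measurableSet_convexHull_range (x : ι → V) :
    MeasurableSet (convexHull ℝ (Set.range x)) :=
  ((Set.finite_range x).isCompact_convexHull (𝕜 := ℝ)).measurableSet

variable [FiniteDimensional ℝ V] (μ : Measure V) [μ.IsAddHaarMeasure]

lemma lintegral_comp_inv_smul (h : V → ENNReal) {s : ℝ} (hs : s ≠ 0) (hh : Measurable h) :
    ∫⁻ z, h (s⁻¹ • z) ∂μ = ENNReal.ofReal |s ^ Module.finrank ℝ V| * ∫⁻ z, h z ∂μ := by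
  rw [← lintegral_map (μ := μ) hh (measurable_const_smul s⁻¹),
    Measure.map_addHaar_smul μ (inv_ne_zero hs), lintegral_smul_measure]
  simp

lemma exists_lintegral_baryPoint_eq (hx : AffineIndependent ℝ x)
    (hcard : Fintype.card ι = Module.finrank ℝ V + 1) :
    ∃ C : ENNReal, ∀ h : V → ENNReal, Measurable h →
      ∫⁻ t, ENNReal.ofReal (∑ i, t i) * h (baryPoint x t) ∂expPi ι =
        C * ∫⁻ y in convexHull ℝ (Set.range x), h y ∂μ := by
  set Δ := convexHull ℝ (Set.range x) with hΔ
  have hΔm : MeasurableSet Δ := measurableSet_convexHull_range x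
  -- The linear equivalence `t ↦ (∑ t i • x i, ∑ t i)`.
  let L₀ : (ι → ℝ) →ₗ[ℝ] V × ℝ :=
    (Fintype.linearCombination ℝ x).prod (Fintype.linearCombination ℝ fun _ => (1 : ℝ))
  have hL₀ (t : ι → ℝ) : L₀ t = (∑ i, t i • x i, ∑ i, t i) := by
    simp [L₀, Fintype.linearCombination_apply]
  have hinj : Function.Injective L₀ := by
    rw [← LinearMap.ker_eq_bot, LinearMap.ker_eq_bot']
    intro t ht
    rw [hL₀, Prod.mk_eq_zero] at ht
    ext i
    exact affineIndependent_iff.1 hx Finset.univ t ht.2 ht.1 i (Finset.mem_univ i)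
  let L : (ι → ℝ) ≃L[ℝ] V × ℝ :=
    (L₀.linearEquivOfInjective hinj (by simp [hcard])).toContinuousLinearEquiv
  have hL (t : ι → ℝ) : L t = (∑ i, t i • x i, ∑ i, t i) := hL₀ t
  have hhaar : (Measure.map L volume).IsAddHaarMeasure := L.isAddHaarMeasure_map volume
  obtain ⟨c, hc⟩ : ∃ c : NNReal, Measure.map L volume = c • μ.prod volume :=
    ⟨_, Measure.isAddLeftInvariant_eq_smul (Measure.map L volume) (μ.prod volume)⟩
  refine ⟨c * ∫⁻ s : ℝ, ENNReal.ofReal (Real.exp (-s)) * ENNReal.ofReal s *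
    ENNReal.ofReal |s ^ Module.finrank ℝ V|, fun h hh => ?_⟩
  let G : V × ℝ → ENNReal := fun p =>
    ENNReal.ofReal (Real.exp (-p.2)) * ENNReal.ofReal p.2 * Δ.indicator h (p.2⁻¹ • p.1)
  have hind : Measurable (Δ.indicator h) := hh.indicator hΔm
  have hG : Measurable G := by
    have : Measurable fun p : V × ℝ => Δ.indicator h (p.2⁻¹ • p.1) :=
      hind.comp (measurable_snd.inv.smul measurable_fst)
    fun_prop
  have hpt (t : ι → ℝ) : (∏ i, exponentialPDF 1 (t i)) *
      (ENNReal.ofReal (∑ i, t i) * h (baryPoint x t)) = G (L t) := by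
    simp only [G, hL]
    change _ = _ * Δ.indicator h (baryPoint x t)
    rcases le_or_gt (∑ i, t i) 0 with hs | hs
    · simp [ENNReal.ofReal_of_nonpos hs]
    by_cases ht : ∀ i, 0 ≤ t i
    · rw [prod_exponentialPDF_of_nonneg ht,
        Set.indicator_of_mem (baryPoint_mem_convexHull ht hs), mul_assoc]
    · rw [Set.indicator_of_notMem
        fun hmem => ht (nonneg_of_baryPoint_mem_convexHull hx hs hmem)]
      push Not at ht
      obtain ⟨i, hi⟩ := ht
      have h0 : ∏ i, exponentialPDF 1 (t i) = 0 :=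
        Finset.prod_eq_zero (Finset.mem_univ i) (exponentialPDF_of_neg hi)
      rw [h0, zero_mul, mul_zero]
  have hfib (s : ℝ) : ∫⁻ z, G (z, s) ∂μ = ENNReal.ofReal (Real.exp (-s)) * ENNReal.ofReal s *
      ENNReal.ofReal |s ^ Module.finrank ℝ V| * ∫⁻ y in Δ, h y ∂μ := by
    rcases eq_or_ne s 0 with rfl | hs
    · simp [G]
    · have hm : Measurable fun z => Δ.indicator h (s⁻¹ • z) :=
        hind.comp (measurable_const_smul s⁻¹)
      simp only [G]
      rw [lintegral_const_mul _ hm,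
        lintegral_comp_inv_smul μ _ hs hind, lintegral_indicator hΔm, ← mul_assoc]
  have hpdf : Measurable fun t : ι → ℝ => ∏ i, exponentialPDF 1 (t i) :=
    Finset.measurable_prod _ fun i _ => (measurable_exponentialPDF 1).comp (measurable_pi_apply i)
  have hint : Measurable fun t : ι → ℝ => ENNReal.ofReal (∑ i, t i) * h (baryPoint x t) :=
    Measurable.mul (by fun_prop) (hh.comp (measurable_baryPoint x))
  rw [expPi_eq_withDensity, lintegral_withDensity_eq_lintegral_mul _ hpdf hint]
  simp only [Pi.mul_apply, hpt]
  rw [← lintegral_map hG L.continuous.measurable, hc, lintegral_smul_measure,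
    lintegral_prod_symm' _ hG]
  simp_rw [hfib]
  rw [lintegral_mul_const _ (by fun_prop), mul_assoc]
  rfl

lemma exists_map_baryPoint_eq (hx : AffineIndependent ℝ x)
    (hcard : Fintype.card ι = Module.finrank ℝ V + 1) :
    ∃ C : ENNReal,
      ((expPi ι).withDensity fun t => ENNReal.ofReal (∑ i, t i)).map (baryPoint x) =
        C • μ.restrict (convexHull ℝ (Set.range x)) := by
  obtain ⟨C, hC⟩ := exists_lintegral_baryPoint_eq μ hx hcard
  refine ⟨C, Measure.ext_of_lintegral _ fun h hh => ?_⟩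
  rw [lintegral_map hh (measurable_baryPoint x), lintegral_smul_measure, smul_eq_mul, ← hC h hh]
  exact lintegral_withDensity_eq_lintegral_mul _ (by fun_prop) (hh.comp (measurable_baryPoint x))

lemma integral_sum_mul_comp_baryPoint (hx : AffineIndependent ℝ x)
    (hcard : Fintype.card ι = Module.finrank ℝ V + 1) {g : V → ℝ}
    (hg : IntegrableOn g (convexHull ℝ (Set.range x)) μ) :
    Integrable (fun t => (∑ i, t i) * g (baryPoint x t)) (expPi ι) ∧
      ∫ t, (∑ i, t i) * g (baryPoint x t) ∂expPi ι =
        Fintype.card ι * ⨍ y in convexHull ℝ (Set.range x), g y ∂μ := by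
  set Δ := convexHull ℝ (Set.range x) with hΔ
  set ν := (expPi ι).withDensity fun t => ENNReal.ofReal (∑ i, t i) with hν
  have hdm : Measurable fun t : ι → ℝ => ENNReal.ofReal (∑ i, t i) := by fun_prop
  have hdf : ∀ᵐ t ∂expPi ι, ENNReal.ofReal (∑ i, t i) < ⊤ :=
    ae_of_all _ fun _ => ENNReal.ofReal_lt_top
  obtain ⟨C, hC⟩ := exists_map_baryPoint_eq μ hx hcard
  rw [← hν, ← hΔ] at hC
  have hmass : C * μ Δ = Fintype.card ι := by
    have h := congrArg (fun m => m Set.univ) hC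
    simp only [Measure.map_apply (measurable_baryPoint x) MeasurableSet.univ, Set.preimage_univ,
      Measure.smul_apply, Measure.restrict_apply_univ, smul_eq_mul] at h
    rw [← h, hν, withDensity_apply _ MeasurableSet.univ, Measure.restrict_univ,
      lintegral_ofReal_sum_expPi]
  have hcard0 : (Fintype.card ι : ENNReal) ≠ 0 := by simp [hcard]
  have hμ0 : μ Δ ≠ 0 := fun h => hcard0 (by rw [← hmass, h, mul_zero])
  have hμt : μ Δ ≠ ⊤ :=
    ((Set.finite_range x).isCompact_convexHull (𝕜 := ℝ)).measure_lt_top.ne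
  have hCt : C ≠ ⊤ := fun h => by
    rw [h, ENNReal.top_mul hμ0] at hmass
    exact ENNReal.natCast_ne_top _ hmass.symm
  have hgC : Integrable g (ν.map (baryPoint x)) := hC ▸ Integrable.smul_measure hg hCt
  have hgν : Integrable (fun t => g (baryPoint x t)) ν :=
    hgC.comp_measurable (measurable_baryPoint x)
  have hae : (fun t => (ENNReal.ofReal (∑ i, t i)).toReal • g (baryPoint x t)) =ᵐ[expPi ι]
      fun t => (∑ i, t i) * g (baryPoint x t) := by
    filter_upwards [ae_expPi_pos] with t ht
    rw [ENNReal.toReal_ofReal (Finset.sum_nonneg fun i _ => (ht i).le), smul_eq_mul]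
  refine ⟨((integrable_withDensity_iff_integrable_smul' hdm hdf).1 hgν).congr hae, ?_⟩
  rw [← integral_congr_ae hae, ← integral_withDensity_eq_integral_toReal_smul hdm hdf, ← hν,
    ← integral_map (measurable_baryPoint x).aemeasurable hgC.aestronglyMeasurable, hC,
    integral_smul_measure, setAverage_eq, smul_eq_mul, smul_eq_mul, ← mul_assoc]
  congr 1
  have h := congrArg ENNReal.toReal hmass
  rw [ENNReal.toReal_mul, ENNReal.toReal_natCast] at h
  rw [← h, Measure.real, mul_assoc, mul_inv_cancel₀ (ENNReal.toReal_ne_zero.2 ⟨hμ0, hμt⟩), mul_one]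

end Pushforward

section Convex

lemma ConvexOn.exists_abs_le_of_mem_convexHull_range {ι E : Type*} [Fintype ι] [AddCommGroup E]
    [Module ℝ E] {x : ι → E} {f : E → ℝ} (hf : ConvexOn ℝ (convexHull ℝ (Set.range x)) f) :
    ∃ B, ∀ y ∈ convexHull ℝ (Set.range x), |f y| ≤ B := by
  set m : ℝ := (Fintype.card ι : ℝ) with hm
  set M : ℝ := ∑ i, |f (x i)| with hM
  set c : E := ∑ i, m⁻¹ • x i with hc
  have hxm (i : ι) : x i ∈ convexHull ℝ (Set.range x) := subset_convexHull ℝ _ ⟨i, rfl⟩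
  refine ⟨m * |f c| + M, fun y hy => abs_le.2 ⟨?_, ?_⟩⟩
  · obtain ⟨w, hw0, hw1, hw⟩ := mem_convexHull_range_iff.1 hy
    have hw_le (i : ι) : w i ≤ 1 :=
      hw1 ▸ Finset.single_le_sum (fun j _ => hw0 j) (Finset.mem_univ i)
    have hne : Nonempty ι := by
      by_contra h
      rw [not_nonempty_iff] at h
      simp at hw1
    have hmpos : 0 < m := by simp [hm, Fintype.card_pos]
    have hsum : ∑ i, m⁻¹ * (1 - w i) = 1 - m⁻¹ := by
      rw [← Finset.mul_sum, Finset.sum_sub_distrib, hw1]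
      simp only [Finset.sum_const, Finset.card_univ, nsmul_eq_mul, mul_one, ← hm]
      field_simp
    have hcy : m⁻¹ • y + ∑ i, (m⁻¹ * (1 - w i)) • x i = c := by
      rw [← hw, Finset.smul_sum, ← Finset.sum_add_distrib]
      refine Finset.sum_congr rfl fun i _ => ?_
      rw [smul_smul, ← add_smul]
      congr 1
      ring
    have hJ := hf.map_add_sum_le (t := Finset.univ) (w := fun i => m⁻¹ * (1 - w i)) (p := x)
      (v := m⁻¹) (q := y)
      (fun i _ => mul_nonneg (inv_nonneg.2 hmpos.le) (sub_nonneg.2 (hw_le i)))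
      (by rw [hsum]; ring) (fun i _ => hxm i) (inv_nonneg.2 hmpos.le) hy
    rw [hcy] at hJ
    have hle : ∑ i, (m⁻¹ * (1 - w i)) • f (x i) ≤ m⁻¹ * M := by
      rw [hM, Finset.mul_sum]
      refine Finset.sum_le_sum fun i _ => ?_
      rw [smul_eq_mul, mul_assoc]
      refine mul_le_mul_of_nonneg_left ?_ (inv_nonneg.2 hmpos.le)
      calc (1 - w i) * f (x i) ≤ (1 - w i) * |f (x i)| :=
            mul_le_mul_of_nonneg_left (le_abs_self _) (sub_nonneg.2 (hw_le i))
        _ ≤ 1 * |f (x i)| :=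
            mul_le_mul_of_nonneg_right (by linarith [hw0 i]) (abs_nonneg _)
        _ = |f (x i)| := one_mul _
    have hfc : m * f c ≤ f y + M := by
      have := mul_le_mul_of_nonneg_left (hJ.trans (add_le_add_right hle _)) hmpos.le
      rw [smul_eq_mul, ← mul_add, mul_inv_cancel_left₀ hmpos.ne'] at this
      exact this
    have := mul_le_mul_of_nonneg_left (neg_abs_le (f c)) hmpos.le
    linarith
  · obtain ⟨_, ⟨i, rfl⟩, hi⟩ := hf.exists_ge_of_mem_convexHull (subset_convexHull ℝ _) hy
    have h1 : |f (x i)| ≤ M :=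
      Finset.single_le_sum (f := fun i => |f (x i)|) (fun _ _ => abs_nonneg _) (Finset.mem_univ i)
    have h2 : 0 ≤ m * |f c| := by positivity
    linarith [le_abs_self (f (x i))]

lemma ConvexOn.integrableOn_convexHull_range {ι V : Type*} [Fintype ι] [NormedAddCommGroup V]
    [NormedSpace ℝ V] [MeasurableSpace V] [BorelSpace V] [FiniteDimensional ℝ V]
    (μ : Measure V) [μ.IsAddHaarMeasure] {x : ι → V} {f : V → ℝ}
    (hf : ConvexOn ℝ (convexHull ℝ (Set.range x)) f) :
    IntegrableOn f (convexHull ℝ (Set.range x)) μ := by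
  obtain ⟨B, hB⟩ := hf.exists_abs_le_of_mem_convexHull_range
  set Δ := convexHull ℝ (Set.range x)
  have hae : (interior Δ : Set V) =ᵐ[μ] Δ :=
    interior_ae_eq_of_null_frontier ((convex_convexHull ℝ _).addHaar_frontier μ)
  have hm : AEStronglyMeasurable f (μ.restrict Δ) := by
    rw [← Measure.restrict_congr_set hae]
    exact hf.continuousOn_interior.aestronglyMeasurable isOpen_interior.measurableSet
  exact IntegrableOn.of_bound
    ((Set.finite_range x).isCompact_convexHull (𝕜 := ℝ)).measure_lt_top hm B
    ((ae_restrict_mem (measurableSet_convexHull_range x)).mono hB)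

end Convex

section Hausdorff

variable {ι E : Type*} [Fintype ι] [NormedAddCommGroup E] [NormedSpace ℝ E]
  [MeasurableSpace E] [BorelSpace E] {x : ι → E}

lemma setAverage_hausdorffMeasure_image {X Y : Type*} [MetricSpace X] [CompleteSpace X]
    [MeasurableSpace X] [BorelSpace X] [MetricSpace Y] [MeasurableSpace Y] [BorelSpace Y]
    {φ : X → Y} (hφ : Isometry φ) {r : ℝ} (hr : 0 ≤ r) (f : Y → ℝ) (S : Set X) :
    ⨍ y in φ '' S, f y ∂μH[r] = ⨍ y in S, f (φ y) ∂μH[r] := by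
  have hemb : MeasurableEmbedding φ := hφ.isClosedEmbedding.measurableEmbedding
  have hres : (μH[r] : Measure Y).restrict (φ '' S) =
      ((μH[r] : Measure X).map φ).restrict (φ '' S) := by
    rw [hφ.map_hausdorffMeasure (Or.inl hr),
      Measure.restrict_restrict_of_subset (Set.image_subset_range φ S)]
  rw [setAverage_eq, setAverage_eq, Measure.real, Measure.real,
    hφ.hausdorffMeasure_image (Or.inl hr), hres, hemb.setIntegral_map,
    Set.preimage_image_eq _ hφ.injective]

lemma integral_sum_mul_comp_baryPoint_hausdorff [Nonempty ι] (hx : AffineIndependent ℝ x)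
    {f : E → ℝ} (hf : ConvexOn ℝ (convexHull ℝ (Set.range x)) f) :
    Integrable (fun t => (∑ i, t i) * f (baryPoint x t)) (expPi ι) ∧
      ∫ t, (∑ i, t i) * f (baryPoint x t) ∂expPi ι =
        Fintype.card ι *
          ⨍ y in convexHull ℝ (Set.range x), f y ∂μH[(Fintype.card ι : ℝ) - 1] := by
  let V := vectorSpan ℝ (Set.range x)
  obtain ⟨i₀⟩ := ‹Nonempty ι›
  have hcard : Fintype.card ι = Module.finrank ℝ V + 1 := by
    obtain ⟨k, hk⟩ := Nat.exists_eq_succ_of_ne_zero (Fintype.card_ne_zero (α := ι))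
    rw [hx.finrank_vectorSpan hk, hk]
  have : FiniteDimensional ℝ V := finiteDimensional_vectorSpan_of_finite ℝ (Set.finite_range x)
  let φ : V →ᵃ[ℝ] E := V.subtype.toAffineMap + AffineMap.const ℝ V (x i₀)
  have hφ (v : V) : φ v = v + x i₀ := rfl
  have hiso : Isometry φ := Isometry.of_dist_eq fun v w => by simp [hφ]; rfl
  let x' : ι → V := fun i =>
    ⟨x i - x i₀, vsub_mem_vectorSpan ℝ (Set.mem_range_self i) (Set.mem_range_self i₀)⟩
  have hφx : φ ∘ x' = x := by
    ext i
    simp [hφ, x']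
  have hx' : AffineIndependent ℝ x' := AffineIndependent.of_comp φ (hφx.symm ▸ hx)
  have hΔ : convexHull ℝ (Set.range x) = φ '' convexHull ℝ (Set.range x') := by
    rw [AffineMap.image_convexHull, ← Set.range_comp, hφx]
  have hf' : ConvexOn ℝ (convexHull ℝ (Set.range x')) (f ∘ φ) := by
    have h := hf.comp_affineMap φ
    rwa [hΔ, Set.preimage_image_eq _ hiso.injective] at h
  have hae : (fun t => (∑ i, t i) * (f ∘ φ) (baryPoint x' t)) =ᵐ[expPi ι]
      fun t => (∑ i, t i) * f (baryPoint x t) := by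
    filter_upwards [ae_expPi_pos] with t ht
    have hs : ∑ i, t i ≠ 0 := (Finset.sum_pos (fun i _ => ht i) ⟨i₀, Finset.mem_univ _⟩).ne'
    have : φ (baryPoint x' t) = baryPoint x t := by
      simp only [hφ, baryPoint, x', Submodule.coe_smul, Submodule.coe_sum, smul_sub,
        Finset.sum_sub_distrib, ← Finset.sum_smul, inv_smul_smul₀ hs, sub_add_cancel]
    rw [Function.comp_apply, this]
  obtain ⟨h1, h2⟩ := integral_sum_mul_comp_baryPoint (μH[Module.finrank ℝ V]) hx' hcard
    (hf'.integrableOn_convexHull_range _)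
  refine ⟨h1.congr hae, ?_⟩
  rw [← integral_congr_ae hae, h2, hΔ, show (Fintype.card ι : ℝ) - 1 = Module.finrank ℝ V by
    rw [hcard]; push_cast; ring, setAverage_hausdorffMeasure_image hiso (Nat.cast_nonneg _)]
  rfl

end Hausdorff

section Partition

variable {ι κ : Type*} [Fintype ι] [Fintype κ] [DecidableEq κ]

lemma ConvexOn.sum_mul_baryPoint_le {E : Type*} [AddCommGroup E] [Module ℝ E] {x : ι → E}
    {f : E → ℝ} (hf : ConvexOn ℝ (convexHull ℝ (Set.range x)) f) {K : κ → Finset ι} {c : ι → κ}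
    (hK : ∀ j, K j = Finset.univ.filter (c · = j)) (hne : ∀ j, (K j).Nonempty)
    {t : ι → ℝ} (ht : ∀ i, 0 < t i) :
    (∑ i, t i) * f (baryPoint x t) ≤
      ∑ j, (∑ i, (K j).restrict t i) *
        f (baryPoint (fun i : K j => x i) ((K j).restrict t)) := by
  rcases isEmpty_or_nonempty ι with hι | hι
  · simp [Finset.eq_empty_of_isEmpty]
  have hs : 0 < ∑ i, t i := Finset.sum_pos (fun i _ => ht i) Finset.univ_nonempty
  set s := ∑ i, t i with hs_def
  set S : κ → ℝ := fun j => ∑ i, (K j).restrict t i with hS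
  set p : κ → E := fun j => baryPoint (fun i : K j => x i) ((K j).restrict t) with hp
  have hSpos (j : κ) : 0 < S j := by
    have := (hne j).to_subtype
    exact Finset.sum_pos (fun i _ => ht i) Finset.univ_nonempty
  have hSsum : ∑ j, S j = s := by
    simp only [hS, Finset.restrict, Finset.sum_coe_sort (f := t), hK, hs_def]
    exact Finset.sum_fiberwise _ c t
  have hpmem (j : κ) : p j ∈ convexHull ℝ (Set.range x) := by
    refine convexHull_mono ?_ (baryPoint_mem_convexHull (fun i => (ht i).le) (hSpos j))
    rintro _ ⟨i, rfl⟩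
    exact ⟨i, rfl⟩
  have hpt : ∑ j, (s⁻¹ * S j) • p j = baryPoint x t := by
    have h (j : κ) : (s⁻¹ * S j) • p j = s⁻¹ • ∑ i with c i = j, t i • x i := by
      rw [mul_smul, ← hK j, ← Finset.sum_coe_sort (K j) (fun i => t i • x i)]
      congr 1
      exact smul_inv_smul₀ (hSpos j).ne' _
    simp_rw [h, ← Finset.smul_sum, Finset.sum_fiberwise]
    rfl
  have hJ := hf.map_sum_le (t := Finset.univ) (w := fun j => s⁻¹ * S j) (p := p)
    (fun j _ => mul_nonneg (inv_nonneg.2 hs.le) (hSpos j).le)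
    (by rw [← Finset.mul_sum, hSsum, inv_mul_cancel₀ hs.ne']) (fun j _ => hpmem j)
  rw [hpt] at hJ
  calc s * f (baryPoint x t) ≤ s * ∑ j, (s⁻¹ * S j) • f (p j) :=
        mul_le_mul_of_nonneg_left hJ hs.le
    _ = ∑ j, S j * f (p j) := by
        simp_rw [smul_eq_mul, mul_assoc, ← Finset.mul_sum, mul_inv_cancel_left₀ hs.ne']

variable {E : Type*} [NormedAddCommGroup E] [NormedSpace ℝ E]
  [MeasurableSpace E] [BorelSpace E] {x : ι → E} {f : E → ℝ}

lemma card_mul_setAverage_le_sum_fiber [Nonempty ι] (hx : AffineIndependent ℝ x)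
    (hf : ConvexOn ℝ (convexHull ℝ (Set.range x)) f) {K : κ → Finset ι} {c : ι → κ}
    (hK : ∀ j, K j = Finset.univ.filter (c · = j)) (hne : ∀ j, (K j).Nonempty) :
    Fintype.card ι * ⨍ y in convexHull ℝ (Set.range x), f y ∂μH[(Fintype.card ι : ℝ) - 1] ≤
      ∑ j, (K j).card * ⨍ y in convexHull ℝ (x '' K j), f y ∂μH[((K j).card : ℝ) - 1] := by
  have hface (j : κ) := by
    have := (hne j).to_subtype
    refine integral_sum_mul_comp_baryPoint_hausdorff (x := fun i : K j => x i) (f := f)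
      (hx.comp_embedding (Function.Embedding.subtype _)) (hf.subset (convexHull_mono ?_)
        (convex_convexHull ℝ _))
    rintro _ ⟨i, rfl⟩
    exact ⟨i, rfl⟩
  have hrange (j : κ) : Set.range (fun i : K j => x i) = x '' K j := by
    ext; simp
  simp_rw [hrange, Fintype.card_coe] at hface
  have hmp (j : κ) : MeasurePreserving (K j).restrict (expPi ι) (expPi (K j)) :=
    ⟨Finset.measurable_restrict _, expPi_map_restrict _⟩
  obtain ⟨hint, hval⟩ := integral_sum_mul_comp_baryPoint_hausdorff hx hf
  have hcomp (j : κ) : Integrable (fun t => (∑ i, (K j).restrict t i) *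
      f (baryPoint (fun i : K j => x i) ((K j).restrict t))) (expPi ι) :=
    (hmp j).integrable_comp_of_integrable (hface j).1
  rw [← hval]
  calc _ ≤ ∫ t, ∑ j, (∑ i, (K j).restrict t i) *
        f (baryPoint (fun i : K j => x i) ((K j).restrict t)) ∂expPi ι := by
        refine integral_mono_ae hint (integrable_finsetSum _ fun j _ => hcomp j) ?_
        filter_upwards [ae_expPi_pos] with t ht using hf.sum_mul_baryPoint_le hK hne ht
    _ = _ := by
        rw [integral_finsetSum _ fun j _ => hcomp j]
        refine Finset.sum_congr rfl fun j _ => ?_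
        have hmeas := (hface j).1.aestronglyMeasurable
        rw [← (hmp j).map_eq] at hmeas
        rw [← (hface j).2, ← (hmp j).map_eq,
          integral_map (hmp j).measurable.aemeasurable hmeas]

end Partition

section Symmetrization

variable {ι : Type*} [Fintype ι] [DecidableEq ι]

lemma Finset.exists_perm_map_eq {A B : Finset ι} (h : A.card = B.card) :
    ∃ σ : Equiv.Perm ι, A.map σ.toEmbedding = B := by
  have e : {i // i ∈ A} ≃ {i // i ∈ B} := Fintype.equivOfCardEq (by simpa using h)
  refine ⟨e.extendSubtype, Finset.eq_of_subset_of_card_le ?_ (by simp [h])⟩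
  intro i hi
  obtain ⟨a, ha, rfl⟩ := Finset.mem_map.1 hi
  exact e.extendSubtype_mem a ha

lemma choose_mul_sum_perm_map (h : Finset ι → ℝ) {d : ℕ} {B : Finset ι} (hB : B.card = d) :
    ((Fintype.card ι).choose d : ℝ) * ∑ σ : Equiv.Perm ι, h (B.map σ.toEmbedding) =
      (Fintype.card ι).factorial * ∑ K ∈ Finset.powersetCard d Finset.univ, h K := by
  have hconst : ∀ K ∈ Finset.powersetCard d (Finset.univ : Finset ι),
      ∑ σ : Equiv.Perm ι, h (K.map σ.toEmbedding) =
        ∑ σ : Equiv.Perm ι, h (B.map σ.toEmbedding) := by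
    intro K hK
    obtain ⟨τ, rfl⟩ := Finset.exists_perm_map_eq (hB.trans (Finset.mem_powersetCard.1 hK).2.symm)
    refine Fintype.sum_equiv (Equiv.mulRight τ) _ _ fun σ => ?_
    rw [Finset.map_map]
    rfl
  have hperm (σ : Equiv.Perm ι) :
      ∑ K ∈ Finset.powersetCard d (Finset.univ : Finset ι), h (K.map σ.toEmbedding) =
        ∑ K ∈ Finset.powersetCard d (Finset.univ : Finset ι), h K := by
    refine Finset.sum_equiv σ.finsetCongr (fun K => ?_) fun K _ => rfl
    simp [Finset.mem_powersetCard]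
  calc _ = ∑ K ∈ Finset.powersetCard d (Finset.univ : Finset ι),
        ∑ σ : Equiv.Perm ι, h (K.map σ.toEmbedding) := by
        rw [Finset.sum_congr rfl hconst]
        simp [Finset.card_powersetCard]
    _ = _ := by
        rw [Finset.sum_comm]
        simp [hperm, Fintype.card_perm]

end Symmetrization

theorem avg_le_avg_d_faces (n d : ℕ) (hd : d ∣ n + 1)
    (x : Fin (n + 1) → EuclideanSpace ℝ (Fin n)) (hx : AffineIndependent ℝ x)
    (f : EuclideanSpace ℝ (Fin n) → ℝ)
    (hf : ConvexOn ℝ (convexHull ℝ (Set.range x)) f) :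
    avgH f (n : ℝ) (convexHull ℝ (Set.range x)) ≤
      ((n + 1).choose d : ℝ)⁻¹ *
        ∑ K ∈ Finset.powersetCard d (Finset.univ : Finset (Fin (n + 1))),
          avgH f ((d : ℝ) - 1) (convexHull ℝ (x '' ↑K)) := by
  obtain ⟨k, hk⟩ := hd
  have hdpos : 0 < d := Nat.pos_of_ne_zero (by rintro rfl; simp at hk)
  let e : Fin (n + 1) ≃ Fin d × Fin k := (finCongr hk).trans finProdFinEquiv.symm
  let B : Fin k → Finset (Fin (n + 1)) := fun j => Finset.univ.filter fun i => (e i).2 = j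
  have hB (j : Fin k) : (B j).card = d := by
    have hinj : Function.Injective fun a : Fin d => e.symm (a, j) := fun a b h => by simpa using h
    have : B j = Finset.univ.image fun a : Fin d => e.symm (a, j) := by
      ext i
      simp only [B, Finset.mem_filter, Finset.mem_univ, true_and, Finset.mem_image]
      refine ⟨fun h => ⟨(e i).1, ?_⟩, ?_⟩
      · rw [← h, Prod.mk.eta, e.symm_apply_apply]
      · rintro ⟨a, rfl⟩
        simp
    rw [this, Finset.card_image_of_injective _ hinj, Finset.card_univ, Fintype.card_fin]
  set A : Finset (Fin (n + 1)) → ℝ := fun K => avgH f ((d : ℝ) - 1) (convexHull ℝ (x '' ↑K))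
  have hpart (σ : Equiv.Perm (Fin (n + 1))) :
      ((n + 1 : ℕ) : ℝ) * avgH f n (convexHull ℝ (Set.range x)) ≤
        d * ∑ j, A ((B j).map σ.toEmbedding) := by
    have hc (j : Fin k) : ((B j).map σ.toEmbedding).card = d := by simp [hB]
    have h := card_mul_setAverage_le_sum_fiber hx hf
      (K := fun j => (B j).map σ.toEmbedding) (c := fun i => (e (σ.symm i)).2)
      (fun j => by ext i; simp [B, Finset.mem_map_equiv])
      (fun j => Finset.card_pos.1 (by rw [hc]; exact hdpos))
    simp only [hc, Fintype.card_fin, ← Finset.mul_sum] at h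
    rw [show ((n + 1 : ℕ) : ℝ) - 1 = n by push_cast; ring] at h
    exact h
  have hchoose : (0 : ℝ) < (n + 1).choose d := by
    exact_mod_cast Nat.choose_pos (Nat.le_of_dvd n.succ_pos ⟨k, hk⟩)
  have hsymm (j : Fin k) : ∑ σ : Equiv.Perm (Fin (n + 1)), A ((B j).map σ.toEmbedding) =
      ((n + 1).choose d : ℝ)⁻¹ *
        ((n + 1).factorial * ∑ K ∈ Finset.powersetCard d Finset.univ, A K) := by
    have h := choose_mul_sum_perm_map A (hB j)
    rw [Fintype.card_fin] at h
    rw [← h, inv_mul_cancel_left₀ hchoose.ne']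
  have hsum := Finset.sum_le_sum fun σ (_ : σ ∈ Finset.univ) => hpart σ
  rw [← Finset.mul_sum Finset.univ (fun σ : Equiv.Perm (Fin (n + 1)) =>
    ∑ j, A ((B j).map σ.toEmbedding)), Finset.sum_comm] at hsum
  simp only [hsymm, Finset.sum_const, Finset.card_univ, Fintype.card_perm, Fintype.card_fin,
    nsmul_eq_mul] at hsum
  have hk' : ((n + 1 : ℕ) : ℝ) = d * k := by exact_mod_cast hk
  have hpos : (0 : ℝ) < (n + 1).factorial * ((n + 1 : ℕ) : ℝ) := by positivity
  refine le_of_mul_le_mul_left ?_ hpos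
  calc _ = (n + 1).factorial * (((n + 1 : ℕ) : ℝ) * avgH f n (convexHull ℝ (Set.range x))) := by
        ring
    _ ≤ _ := hsum
    _ = _ := by rw [hk']; ring
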